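/- (Deterministic specialization of the paper's Theorem 2.) In the deterministic k-system setting of the context, let S be a uniformly random subset of E (each item included independently with probability 1/2), so Exp_S[h(S)] = 2^(-|E|) * sum over all subsets S of E of h(S). Then Exp_S[ g(G(S)) ] >= (1/(2k+4)) * (max of g(T) over all finsets T with T independent). -/

import Mathlib

open Finset

variable {E : Type*}

/-- Pick, from a nonempty finset `F`, the element maximizing the score `r`,
breaking ties by taking the least such element in the fixed linear order. -/
noncomputable def pick [LinearOrder E] (F : Finset E) (r : E → ℝ) (h : F.Nonempty) : E :=
  (F.filter fun e => ∀ e' ∈ F, r e' ≤ r e).min' (by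
    obtain ⟨a, ha, hm⟩ := F.exists_max_image r h
    exact ⟨a, Finset.mem_filter.mpr ⟨ha, hm⟩⟩)

/-- `B` is a base of `R` for the independence system `Indep`. -/
def IsBase [DecidableEq E] (Indep : Finset E → Prop) (R B : Finset E) : Prop :=
  B ⊆ R ∧ Indep B ∧ ∀ e ∈ R \ B, ¬ Indep (insert e B)

/-- One pass of greedy with fuel `n`: `V` is the set selected so far. -/
noncomputable def greedyAux [DecidableEq E] [LinearOrder E]
    (g : Finset E → ℝ) (Indep : Finset E → Prop) [DecidablePred Indep] (S : Finset E) :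
    ℕ → Finset E → Finset E
  | 0, V => V
  | n + 1, V =>
    let F := S.filter fun e => e ∉ V ∧ Indep (insert e V) ∧ 0 < g (insert e V) - g V
    if h : F.Nonempty then
      let e := pick F (fun e => g (insert e V) - g V) h
      greedyAux g Indep S n (insert e V)
    else V

/-- The output of greedy run on the available item set `S`. -/
noncomputable def greedy [Fintype E] [DecidableEq E] [LinearOrder E]
    (g : Finset E → ℝ) (Indep : Finset E → Prop) [DecidablePred Indep] (S : Finset E) :
    Finset E :=
  greedyAux g Indep S (Fintype.card E) ∅

section Submodular

variable [DecidableEq E] {g : Finset E → ℝ}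

lemma marginal_antitone (hsub : ∀ S T : Finset E, g (S ∪ T) + g (S ∩ T) ≤ g S + g T)
    {A B : Finset E} (hAB : A ⊆ B) {e : E} (he : e ∉ B) :
    g (insert e B) - g B ≤ g (insert e A) - g A := by
  have h := hsub (insert e A) B
  rw [insert_union, union_eq_right.mpr hAB, insert_inter_of_notMem he,
    inter_eq_left.mpr hAB] at h
  linarith

lemma le_add_sum_marginal (hsub : ∀ S T : Finset E, g (S ∪ T) + g (S ∩ T) ≤ g S + g T)
    (V D : Finset E) (hD : Disjoint D V) :
    g (V ∪ D) ≤ g V + ∑ e ∈ D, (g (insert e V) - g V) := by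
  induction D using Finset.induction_on with
  | empty => simp
  | insert a D ha ih =>
    rw [disjoint_insert_left] at hD
    have haV : a ∉ V ∪ D := by simp [ha, hD.1]
    have h := marginal_antitone hsub (subset_union_left (s₁ := V) (s₂ := D)) haV
    rw [sum_insert ha, union_insert]
    linarith [ih hD.2]

lemma half_le_sum_union [Fintype E] (hg : ∀ S : Finset E, 0 ≤ g S)
    (hsub : ∀ S T : Finset E, g (S ∪ T) + g (S ∩ T) ≤ g S + g T)
    (V : Finset E → Finset E) (hV : ∀ S, V S ⊆ S) (O : Finset E) :
    (2 : ℝ) ^ Fintype.card E * g O ≤ 2 * ∑ S : Finset E, g (V S ∪ O) := by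
  have hcompl : ∑ S : Finset E, g (V Sᶜ ∪ O) = ∑ S : Finset E, g (V S ∪ O) :=
    Equiv.sum_comp (compl_involutive (α := Finset E)).toPerm fun S => g (V S ∪ O)
  have hpair : ∀ S ∈ (univ : Finset (Finset E)), g O ≤ g (V S ∪ O) + g (V Sᶜ ∪ O) := by
    intro S _
    have h := hsub (V S ∪ O) (V Sᶜ ∪ O)
    have hdisj : Disjoint (V S) (V Sᶜ) :=
      disjoint_of_subset_left (hV S) (disjoint_of_subset_right (hV Sᶜ) disjoint_compl_right)
    rw [← inter_union_distrib_right, disjoint_iff_inter_eq_empty.mp hdisj, empty_union] at h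
    linarith [hg (V S ∪ O ∪ (V Sᶜ ∪ O))]
  have h := sum_le_sum hpair
  rw [sum_add_distrib, hcompl, sum_const, card_univ, Fintype.card_finset, nsmul_eq_mul] at h
  push_cast at h
  linarith

end Submodular

lemma sum_sdiff_insert_eq_sum_inter [Fintype E] [DecidableEq E] (O : Finset E)
    (φ : Finset E → E → ℝ) :
    ∑ S : Finset E, ∑ o ∈ O \ S, φ (insert o S) o = ∑ S : Finset E, ∑ o ∈ O ∩ S, φ S o := by
  have h₁ : ∀ S : Finset E, ∑ o ∈ O \ S, φ (insert o S) o
      = ∑ o ∈ O, if o ∉ S then φ (insert o S) o else 0 := fun S => by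
    rw [← sum_filter, sdiff_eq_filter]
  have h₂ : ∀ S : Finset E, ∑ o ∈ O ∩ S, φ S o = ∑ o ∈ O, if o ∈ S then φ S o else 0 :=
    fun S => by rw [← sum_filter, filter_mem_eq_inter]
  simp only [h₁, h₂]
  rw [sum_comm, sum_comm (s := univ)]
  refine sum_congr rfl fun o _ => ?_
  rw [← sum_filter, ← sum_filter]
  refine sum_nbij' (insert o) (fun S => S.erase o) ?_ ?_ ?_ ?_ ?_ <;> simp +contextual

section IndependenceSystem

variable [DecidableEq E] {Indep : Finset E → Prop}

lemma exists_isBase_superset {A R : Finset E} (hA : Indep A) (hAR : A ⊆ R) :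
    ∃ B, A ⊆ B ∧ IsBase Indep R B := by
  classical
  obtain ⟨B, hB, hmax⟩ := (R.powerset.filter fun B => A ⊆ B ∧ Indep B).exists_max_image card
    ⟨A, by simp [hA, hAR]⟩
  simp only [mem_filter, mem_powerset] at hB hmax
  refine ⟨B, hB.2.1, hB.1, hB.2.2, fun e he hind => ?_⟩
  rw [mem_sdiff] at he
  have h := hmax (insert e B)
    ⟨insert_subset he.1 hB.1, hB.2.1.trans (subset_insert _ _), hind⟩
  rw [card_insert_of_notMem he.2] at h
  omega

lemma card_blocked_le {k : ℕ}
    (hksys : ∀ R B1 B2 : Finset E, IsBase Indep R B1 → IsBase Indep R B2 →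
      B1.card ≤ k * B2.card)
    {V A : Finset E} (hV : Indep V) (hA : Indep A) (hblock : ∀ o ∈ A, ¬ Indep (insert o V)) :
    A.card ≤ k * V.card := by
  obtain ⟨B, hAB, hB⟩ := exists_isBase_superset hA (subset_union_left (s₁ := A) (s₂ := V))
  refine (card_le_card hAB).trans (hksys _ _ _ hB ⟨subset_union_right, hV, fun e he => ?_⟩)
  rw [mem_sdiff, mem_union] at he
  exact hblock e (he.1.resolve_right he.2)

end IndependenceSystem

section Pick

variable [LinearOrder E] {F F' : Finset E} {r : E → ℝ}

lemma pick_mem_filter (h : F.Nonempty) :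
    pick F r h ∈ F.filter fun e => ∀ e' ∈ F, r e' ≤ r e := min'_mem _ _

lemma pick_mem (h : F.Nonempty) : pick F r h ∈ F := (mem_filter.mp (pick_mem_filter h)).1

lemma le_pick (h : F.Nonempty) {e : E} (he : e ∈ F) : r e ≤ r (pick F r h) :=
  (mem_filter.mp (pick_mem_filter h)).2 e he

lemma pick_le (h : F.Nonempty) {e : E} (he : e ∈ F) (hmax : ∀ e' ∈ F, r e' ≤ r e) :
    pick F r h ≤ e := min'_le _ _ (mem_filter.mpr ⟨he, hmax⟩)

lemma pick_eq_of_subset (hFF : F' ⊆ F) (h : F.Nonempty) (h' : F'.Nonempty)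
    (hmem : pick F r h ∈ F') : pick F' r h' = pick F r h := by
  refine le_antisymm (pick_le h' hmem fun e he => le_pick h (hFF he)) ?_
  exact pick_le h (hFF (pick_mem h')) fun e he => (le_pick h he).trans (le_pick h' hmem)

end Pick

section Greedy

variable [DecidableEq E] {g : Finset E → ℝ} {Indep : Finset E → Prop} [DecidablePred Indep]

variable (g Indep) in
/-- The elements of `S` that greedy may add to `V`. -/
noncomputable def candidates (S V : Finset E) : Finset E :=
  S.filter fun e => e ∉ V ∧ Indep (insert e V) ∧ 0 < g (insert e V) - g V

lemma mem_candidates {S V : Finset E} {e : E} : e ∈ candidates g Indep S V ↔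
    e ∈ S ∧ e ∉ V ∧ Indep (insert e V) ∧ 0 < g (insert e V) - g V := by
  simp [candidates]

lemma candidates_mono {S S' : Finset E} (h : S ⊆ S') (V : Finset E) :
    candidates g Indep S V ⊆ candidates g Indep S' V := filter_subset_filter _ h

variable [LinearOrder E]

variable (g Indep) in
/-- The element greedy adds to `V`. -/
noncomputable def nextElem (S V : Finset E) (h : (candidates g Indep S V).Nonempty) : E :=
  pick (candidates g Indep S V) (fun e => g (insert e V) - g V) h

lemma nextElem_mem {S V : Finset E} (h : (candidates g Indep S V).Nonempty) :
    nextElem g Indep S V h ∈ candidates g Indep S V := pick_mem h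

lemma marginal_le_nextElem {S V : Finset E} (h : (candidates g Indep S V).Nonempty) {e : E}
    (he : e ∈ S) (heV : e ∉ V) (hind : Indep (insert e V)) :
    g (insert e V) - g V ≤ g (insert (nextElem g Indep S V h) V) - g V := by
  by_cases hpos : 0 < g (insert e V) - g V
  · exact le_pick (r := fun e => g (insert e V) - g V) h (mem_candidates.mpr ⟨he, heV, hind, hpos⟩)
  · exact (not_lt.mp hpos).trans (mem_candidates.mp (nextElem_mem h)).2.2.2.le

lemma nextElem_eq_of_subset {S S' V : Finset E} (hSS : S ⊆ S')
    (h' : (candidates g Indep S' V).Nonempty) (hmem : nextElem g Indep S' V h' ∈ S) :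
    ∃ h : (candidates g Indep S V).Nonempty,
      nextElem g Indep S V h = nextElem g Indep S' V h' := by
  have hmem' : nextElem g Indep S' V h' ∈ candidates g Indep S V :=
    mem_candidates.mpr ⟨hmem, (mem_candidates.mp (nextElem_mem h')).2⟩
  exact ⟨⟨_, hmem'⟩, pick_eq_of_subset (candidates_mono hSS V) h' ⟨_, hmem'⟩ hmem'⟩

lemma greedyAux_succ_of_nonempty {S V : Finset E} (n : ℕ)
    (h : (candidates g Indep S V).Nonempty) :
    greedyAux g Indep S (n + 1) V
      = greedyAux g Indep S n (insert (nextElem g Indep S V h) V) := by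
  rw [greedyAux]
  exact dif_pos h

lemma greedyAux_succ_of_not_nonempty {S V : Finset E} (n : ℕ)
    (h : ¬ (candidates g Indep S V).Nonempty) : greedyAux g Indep S (n + 1) V = V := by
  rw [greedyAux]
  exact dif_neg h

lemma subset_greedyAux (S : Finset E) (n : ℕ) (V : Finset E) :
    V ⊆ greedyAux g Indep S n V := by
  induction n generalizing V with
  | zero => exact Subset.rfl
  | succ n ih =>
    by_cases h : (candidates g Indep S V).Nonempty
    · rw [greedyAux_succ_of_nonempty n h]
      exact (subset_insert _ _).trans (ih _)
    · rw [greedyAux_succ_of_not_nonempty n h]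

lemma greedyAux_subset (S : Finset E) (n : ℕ) (V : Finset E) :
    greedyAux g Indep S n V ⊆ S ∪ V := by
  induction n generalizing V with
  | zero => exact subset_union_right
  | succ n ih =>
    by_cases h : (candidates g Indep S V).Nonempty
    · rw [greedyAux_succ_of_nonempty n h]
      refine (ih _).trans (union_subset subset_union_left (insert_subset ?_ subset_union_right))
      exact mem_union_left _ (mem_candidates.mp (nextElem_mem h)).1
    · rw [greedyAux_succ_of_not_nonempty n h]
      exact subset_union_right

/-- Adding to the ground set elements that greedy would individually not pick does not change
its output. -/
lemma greedyAux_union_eq {S R : Finset E} (n : ℕ) (V : Finset E)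
    (hR : ∀ o ∈ R, o ∉ greedyAux g Indep (insert o S) n V) :
    greedyAux g Indep (S ∪ R) n V = greedyAux g Indep S n V := by
  induction n generalizing V with
  | zero => rfl
  | succ n ih =>
    by_cases h : (candidates g Indep (S ∪ R) V).Nonempty
    · have hnot : nextElem g Indep (S ∪ R) V h ∉ R := fun hmem => by
        obtain ⟨h', he⟩ := nextElem_eq_of_subset
          (insert_subset (mem_union_right S hmem) subset_union_left) h (mem_insert_self _ S)
        apply hR _ hmem
        rw [greedyAux_succ_of_nonempty n h', he]
        exact subset_greedyAux _ _ _ (mem_insert_self _ _)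
      have hS : nextElem g Indep (S ∪ R) V h ∈ S :=
        (mem_union.mp (mem_candidates.mp (nextElem_mem h)).1).resolve_right hnot
      obtain ⟨h', he⟩ := nextElem_eq_of_subset subset_union_left h hS
      rw [greedyAux_succ_of_nonempty n h, greedyAux_succ_of_nonempty n h', he]
      refine ih _ fun o ho => ?_
      have hins : insert o S ⊆ S ∪ R :=
        insert_subset (mem_union_right S ho) subset_union_left
      obtain ⟨h₂, he₂⟩ := nextElem_eq_of_subset hins h (mem_insert_of_mem hS)
      rw [← he₂, ← greedyAux_succ_of_nonempty n h₂]
      exact hR o ho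
    · have h' : ¬ (candidates g Indep S V).Nonempty := fun h' =>
        h (h'.mono (candidates_mono subset_union_left V))
      rw [greedyAux_succ_of_not_nonempty n h, greedyAux_succ_of_not_nonempty n h']

variable (g Indep) in
/-- The marginal gain of `e` at the moment greedy adds it, and `0` if it is never added. -/
noncomputable def gainAux (S : Finset E) (e : E) : ℕ → Finset E → ℝ
  | 0, _ => 0
  | n + 1, V =>
    if h : (candidates g Indep S V).Nonempty then
      if nextElem g Indep S V h = e then g (insert e V) - g V
      else gainAux S e n (insert (nextElem g Indep S V h) V)
    else 0

lemma gainAux_nonneg (S : Finset E) (e : E) (n : ℕ) (V : Finset E) :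
    0 ≤ gainAux g Indep S e n V := by
  induction n generalizing V with
  | zero => exact le_rfl
  | succ n ih =>
    rw [gainAux]
    split_ifs with h he
    · have := (mem_candidates.mp (nextElem_mem h)).2.2.2
      rw [he] at this
      exact this.le
    · exact ih _
    · exact le_rfl

lemma gainAux_of_mem {S V : Finset E} {e : E} (n : ℕ) (he : e ∈ V) :
    gainAux g Indep S e n V = 0 := by
  induction n generalizing V with
  | zero => rfl
  | succ n ih =>
    rw [gainAux]
    split_ifs with h heq
    · exact absurd (heq ▸ he) (mem_candidates.mp (nextElem_mem h)).2.1
    · exact ih (mem_insert_of_mem he)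
    · rfl

lemma sum_gainAux [Fintype E] (S : Finset E) (n : ℕ) (V : Finset E) :
    ∑ e, gainAux g Indep S e n V = g (greedyAux g Indep S n V) - g V := by
  induction n generalizing V with
  | zero => simp [gainAux, greedyAux]
  | succ n ih =>
    by_cases h : (candidates g Indep S V).Nonempty
    · set p := nextElem g Indep S V h with hp
      have hstep : ∀ e, gainAux g Indep S e (n + 1) V
          = (if p = e then g (insert p V) - g V else 0)
            + gainAux g Indep S e n (insert p V) := fun e => by
        rw [gainAux, dif_pos h, ← hp]
        split_ifs with he
        · rw [gainAux_of_mem n (he ▸ mem_insert_self _ _), he, add_zero]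
        · rw [zero_add]
      rw [sum_congr rfl fun e _ => hstep e, sum_add_distrib, ih,
        greedyAux_succ_of_nonempty n h, sum_ite_eq]
      simp [← hp]
    · rw [greedyAux_succ_of_not_nonempty n h]
      simp [gainAux, h]

lemma marginal_le_gainAux
    (hsub : ∀ S T : Finset E, g (S ∪ T) + g (S ∩ T) ≤ g S + g T)
    {S V : Finset E} {o : E} (n : ℕ) (hoS : o ∉ S) (hoV : o ∉ V)
    (ho : o ∈ greedyAux g Indep (insert o S) n V) :
    g (insert o (greedyAux g Indep S n V)) - g (greedyAux g Indep S n V)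
      ≤ gainAux g Indep (insert o S) o n V := by
  induction n generalizing V with
  | zero => exact absurd ho hoV
  | succ n ih =>
    by_cases h : (candidates g Indep (insert o S) V).Nonempty
    · rw [gainAux, dif_pos h]
      split_ifs with he
      · refine marginal_antitone hsub (subset_greedyAux S (n + 1) V) fun hmem => ?_
        exact (mem_union.mp (greedyAux_subset S (n + 1) V hmem)).elim hoS hoV
      · have hS : nextElem g Indep (insert o S) V h ∈ S :=
          mem_of_mem_insert_of_ne (mem_candidates.mp (nextElem_mem h)).1 he
        obtain ⟨h', he'⟩ := nextElem_eq_of_subset (subset_insert o S) h hS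
        rw [greedyAux_succ_of_nonempty n h', he']
        rw [greedyAux_succ_of_nonempty n h] at ho
        exact ih (by simp [hoV, Ne.symm he]) ho
    · rw [greedyAux_succ_of_not_nonempty n h] at ho
      exact absurd ho hoV

/-- The elements of `R` that are not yet blocked at `V` lose at most `k` times the remaining gain
of greedy, plus the slack `k * |V| - |blocked|` charged at a bound `M` on the current marginals. -/
lemma sum_marginal_unblocked_le [Fintype E]
    (hsub : ∀ S T : Finset E, g (S ∪ T) + g (S ∩ T) ≤ g S + g T)
    (hdown : ∀ A B : Finset E, Indep A → B ⊆ A → Indep B) {k : ℕ}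
    (hksys : ∀ R B1 B2 : Finset E, IsBase Indep R B1 → IsBase Indep R B2 →
      B1.card ≤ k * B2.card)
    {S R : Finset E} (hR : Indep R) (hRS : R ⊆ S) (n : ℕ) (V : Finset E)
    (hn : Fintype.card E ≤ n + V.card) (hV : Indep V)
    (hdisj : Disjoint R (greedyAux g Indep S n V)) {M : ℝ} (hM : 0 ≤ M)
    (hbound : ∀ e ∈ S, e ∉ V → Indep (insert e V) → g (insert e V) - g V ≤ M) :
    ∑ o ∈ R with Indep (insert o V),
        (g (insert o (greedyAux g Indep S n V)) - g (greedyAux g Indep S n V))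
      ≤ k * (g (greedyAux g Indep S n V) - g V)
        + (k * V.card - (#{o ∈ R | ¬ Indep (insert o V)} : ℝ)) * M := by
  induction n generalizing V M with
  | zero =>
    have hVu : V = univ := by
      rw [← card_eq_iff_eq_univ]
      exact le_antisymm (card_le_univ V) (by simpa using hn)
    have hRe : R = ∅ := disjoint_top.mp (by simpa [greedyAux, hVu] using hdisj)
    simp only [hRe, filter_empty, sum_empty, card_empty, greedyAux, sub_self]
    push_cast
    nlinarith [mul_nonneg (mul_nonneg (Nat.cast_nonneg (α := ℝ) k)
      (Nat.cast_nonneg (α := ℝ) V.card)) hM]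
  | succ n ih =>
    have hslack : (0 : ℝ) ≤ k * V.card - (#{o ∈ R | ¬ Indep (insert o V)} : ℝ) := by
      have : #{o ∈ R | ¬ Indep (insert o V)} ≤ k * V.card :=
        card_blocked_le hksys hV (hdown _ _ hR (filter_subset _ _))
          fun o ho => (mem_filter.mp ho).2
      rw [sub_nonneg]
      exact_mod_cast this
    have hRV : ∀ o ∈ R, o ∉ V := fun o ho hoV =>
      disjoint_left.mp hdisj ho (subset_greedyAux _ _ _ hoV)
    by_cases h : (candidates g Indep S V).Nonempty
    · rw [greedyAux_succ_of_nonempty n h] at hdisj ⊢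
      obtain ⟨hpS, hpV, hpI, hppos⟩ := mem_candidates.mp (nextElem_mem h)
      have hmax := fun e => marginal_le_nextElem (e := e) h
      set p := nextElem g Indep S V h
      set W := greedyAux g Indep S n (insert p V)
      have hVW : V ⊆ W := (subset_insert p V).trans (subset_greedyAux _ _ _)
      have hmono : ∀ o, Indep (insert o (insert p V)) → Indep (insert o V) := fun o ho =>
        hdown _ _ ho (insert_subset_insert o (subset_insert p V))
      have hrec := ih (insert p V) (by rw [card_insert_of_notMem hpV]; omega) hpI hdisj hppos.le
        fun e heS heV heI =>
          (marginal_antitone hsub (subset_insert p V) heV).trans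
            (hmax e heS (fun h => heV (mem_insert_of_mem h)) (hmono e heI))
      rw [card_insert_of_notMem hpV] at hrec
      set N := {o ∈ R | Indep (insert o V) ∧ ¬ Indep (insert o (insert p V))} with hN
      have hsplit : ∀ φ : E → ℝ, ∑ o ∈ R with Indep (insert o V), φ o
          = ∑ o ∈ R with Indep (insert o (insert p V)), φ o + ∑ o ∈ N, φ o := fun φ => by
        rw [← sum_filter_add_sum_filter_not _ fun o => Indep (insert o (insert p V)),
          filter_filter, filter_filter]
        congr 2
        exact filter_congr fun o _ => ⟨fun h => h.2, fun h => ⟨hmono o h, h⟩⟩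
      have hcard : (#{o ∈ R | ¬ Indep (insert o (insert p V))} : ℝ)
          = #{o ∈ R | ¬ Indep (insert o V)} + #N := by
        rw [← Nat.cast_add, ← card_union_of_disjoint]
        · congr 2
          ext o
          have := hmono o
          simp only [hN, mem_filter, mem_union]
          tauto
        · exact disjoint_filter.mpr fun o _ h₁ h₂ => h₁ h₂.1
      have hNsum : ∑ o ∈ N, (g (insert o W) - g W) ≤ #N * (g (insert p V) - g V) := by
        rw [← nsmul_eq_mul]
        refine sum_le_card_nsmul _ _ _ fun o ho => ?_
        obtain ⟨hoR, hoI, _⟩ := mem_filter.mp ho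
        exact (marginal_antitone hsub hVW (disjoint_left.mp hdisj hoR)).trans
          (hmax o (hRS hoR) (hRV o hoR) hoI)
      have hslackM := mul_le_mul_of_nonneg_left (hbound p hpS hpV hpI) hslack
      rw [hcard] at hrec
      rw [hsplit]
      push_cast at hrec
      linarith
    · rw [greedyAux_succ_of_not_nonempty n h, sub_self, mul_zero, zero_add]
      refine (sum_nonpos fun o ho => ?_).trans (mul_nonneg hslack hM)
      obtain ⟨hoR, hoI⟩ := mem_filter.mp ho
      by_contra hpos
      exact h ⟨o, mem_candidates.mpr ⟨hRS hoR, hRV o hoR, hoI, not_le.mp hpos⟩⟩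

lemma sum_marginal_rejected_le [Fintype E] (hg : ∀ S : Finset E, 0 ≤ g S)
    (hsub : ∀ S T : Finset E, g (S ∪ T) + g (S ∩ T) ≤ g S + g T) (hempty : Indep ∅)
    (hdown : ∀ A B : Finset E, Indep A → B ⊆ A → Indep B) {k : ℕ}
    (hksys : ∀ R B1 B2 : Finset E, IsBase Indep R B1 → IsBase Indep R B2 →
      B1.card ≤ k * B2.card)
    {S R : Finset E} (hR : Indep R) (hrej : ∀ o ∈ R, o ∉ greedy g Indep (insert o S)) :
    ∑ o ∈ R, (g (insert o (greedy g Indep S)) - g (greedy g Indep S))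
      ≤ k * g (greedy g Indep S) := by
  have heq : greedy g Indep (S ∪ R) = greedy g Indep S := greedyAux_union_eq _ _ hrej
  have hdisj : Disjoint R (greedy g Indep (S ∪ R)) := disjoint_left.mpr fun o ho hmem => by
    have hins : insert o S ∪ R = S ∪ R := by rw [insert_union, insert_eq_of_mem (by simp [ho])]
    have hsingle : greedy g Indep (insert o S) = greedy g Indep S := by
      have := greedyAux_union_eq (g := g) (Indep := Indep) (S := S) (R := {o})
        (Fintype.card E) ∅ fun o' ho' => hrej o' (mem_singleton.mp ho' ▸ ho)
      rwa [union_comm, ← insert_eq] at this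
    exact hrej o ho (hsingle ▸ heq ▸ hmem)
  obtain ⟨M, hM⟩ := (univ.image fun e : E => g (insert e ∅) - g ∅).exists_le
  have hfree : {o ∈ R | Indep (insert o ∅)} = R :=
    filter_true_of_mem fun o ho => hdown _ _ hR (by simpa using ho)
  have h := sum_marginal_unblocked_le hsub hdown hksys hR subset_union_right (S := S ∪ R)
    (Fintype.card E) ∅ (by simp) hempty hdisj (le_max_right M 0) fun e _ _ _ =>
      (hM _ (mem_image_of_mem _ (mem_univ e))).trans (le_max_left _ _)
  change ∑ o ∈ R with Indep (insert o ∅), (g (insert o (greedy g Indep (S ∪ R)))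
    - g (greedy g Indep (S ∪ R))) ≤ k * (g (greedy g Indep (S ∪ R)) - g ∅) + _ at h
  have hblocked : {o ∈ R | ¬ Indep (insert o ∅)} = ∅ :=
    filter_false_of_mem fun o ho => not_not.mpr (hdown _ _ hR (by simpa using ho))
  rw [hfree, hblocked, heq] at h
  simp only [card_empty, Nat.cast_zero, mul_zero, sub_zero, zero_mul, add_zero] at h
  linarith [mul_nonneg (Nat.cast_nonneg (α := ℝ) k) (hg ∅)]

lemma greedy_subset [Fintype E] (S : Finset E) : greedy g Indep S ⊆ S :=
  (greedyAux_subset S _ ∅).trans (union_empty S).subset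

lemma greedy_union_le [Fintype E] (hg : ∀ S : Finset E, 0 ≤ g S)
    (hsub : ∀ S T : Finset E, g (S ∪ T) + g (S ∩ T) ≤ g S + g T) (hempty : Indep ∅)
    (hdown : ∀ A B : Finset E, Indep A → B ⊆ A → Indep B) {k : ℕ}
    (hksys : ∀ R B1 B2 : Finset E, IsBase Indep R B1 → IsBase Indep R B2 →
      B1.card ≤ k * B2.card)
    {O : Finset E} (hO : Indep O) (S : Finset E) :
    g (greedy g Indep S ∪ O) ≤ (k + 1) * g (greedy g Indep S)
      + ∑ o ∈ O \ S, gainAux g Indep (insert o S) o (Fintype.card E) ∅ := by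
  set V := greedy g Indep S
  have hlin := le_add_sum_marginal hsub V (O \ V) sdiff_disjoint
  rw [union_sdiff_self_eq_union,
    ← sum_filter_add_sum_filter_not _ fun o => o ∈ greedy g Indep (insert o S)] at hlin
  have hrej := sum_marginal_rejected_le hg hsub hempty hdown hksys (S := S)
    (R := {o ∈ O \ V | o ∉ greedy g Indep (insert o S)})
    (hdown _ _ hO ((filter_subset _ _).trans sdiff_subset)) fun o ho => (mem_filter.mp ho).2
  have hnotS : ∀ o ∈ {o ∈ O \ V | o ∈ greedy g Indep (insert o S)}, o ∈ O \ S := fun o ho => by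
    obtain ⟨hoOV, hog⟩ := mem_filter.mp ho
    obtain ⟨hoO, hoV⟩ := mem_sdiff.mp hoOV
    exact mem_sdiff.mpr ⟨hoO, fun hoS => hoV (by rwa [insert_eq_of_mem hoS] at hog)⟩
  have hacc : ∑ o ∈ O \ V with o ∈ greedy g Indep (insert o S), (g (insert o V) - g V)
      ≤ ∑ o ∈ O \ S, gainAux g Indep (insert o S) o (Fintype.card E) ∅ :=
    (sum_le_sum fun o ho => marginal_le_gainAux hsub _ (mem_sdiff.mp (hnotS o ho)).2
      (notMem_empty o) (mem_filter.mp ho).2).trans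
      (sum_le_sum_of_subset_of_nonneg hnotS fun o _ _ => gainAux_nonneg _ _ _ _)
  linarith

lemma sum_gainAux_insert_le [Fintype E] (hg : ∀ S : Finset E, 0 ≤ g S) (O : Finset E) :
    ∑ S : Finset E, ∑ o ∈ O \ S, gainAux g Indep (insert o S) o (Fintype.card E) ∅
      ≤ ∑ S : Finset E, g (greedy g Indep S) := by
  rw [sum_sdiff_insert_eq_sum_inter O fun S o => gainAux g Indep S o (Fintype.card E) ∅]
  refine sum_le_sum fun S _ => ?_
  calc ∑ o ∈ O ∩ S, gainAux g Indep S o (Fintype.card E) ∅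
      ≤ ∑ o, gainAux g Indep S o (Fintype.card E) ∅ :=
        sum_le_sum_of_subset_of_nonneg (subset_univ _) fun o _ _ => gainAux_nonneg _ _ _ _
    _ = g (greedy g Indep S) - g ∅ := sum_gainAux _ _ _
    _ ≤ g (greedy g Indep S) := sub_le_self _ (hg ∅)

end Greedy

theorem deterministic_ksystem_sampled_greedy
    [Fintype E] [DecidableEq E] [LinearOrder E]
    (g : Finset E → ℝ)
    (hg : ∀ S : Finset E, 0 ≤ g S)
    (hsub : ∀ S T : Finset E, g (S ∪ T) + g (S ∩ T) ≤ g S + g T)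
    (Indep : Finset E → Prop) [DecidablePred Indep]
    (hempty : Indep ∅)
    (hdown : ∀ A B : Finset E, Indep A → B ⊆ A → Indep B)
    (k : ℕ) (hk : 1 ≤ k)
    (hksys : ∀ R B1 B2 : Finset E, IsBase Indep R B1 → IsBase Indep R B2 →
      B1.card ≤ k * B2.card) :
    ((2 : ℝ) ^ Fintype.card E)⁻¹ * ∑ S : Finset E, g (greedy g Indep S) ≥
      (1 / (2 * (k : ℝ) + 4)) *
        ((Finset.univ.powerset.filter fun T : Finset E => Indep T).sup'
          ⟨∅, Finset.mem_filter.mpr ⟨Finset.empty_mem_powerset _, hempty⟩⟩ g) := by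
  obtain ⟨O, hO, hsup⟩ := exists_mem_eq_sup'
    (s := Finset.univ.powerset.filter fun T : Finset E => Indep T)
    ⟨∅, Finset.mem_filter.mpr ⟨Finset.empty_mem_powerset _, hempty⟩⟩ g
  have hlow := half_le_sum_union hg hsub (greedy g Indep) greedy_subset O
  have hup := sum_le_sum fun S (_ : S ∈ (univ : Finset (Finset E))) =>
    greedy_union_le hg hsub hempty hdown hksys (mem_filter.mp hO).2 S
  rw [sum_add_distrib, ← mul_sum] at hup
  have hgain := sum_gainAux_insert_le (Indep := Indep) hg O
  rw [hsup, ge_iff_le, inv_mul_eq_div, one_div, inv_mul_eq_div,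
    div_le_div_iff₀ (by positivity) (by positivity)]
  linarith
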